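/- arXiv:0802.1942 — 4 statements merged into one kernel-verified Lean document; each statement's English description precedes it below -/
import Mathlib

section
/- For 1 < p < ∞ with conjugate exponent q and n ≥ 1, letting t = 1/(pq), the ratio f(n,p) = (∫_{B_p^n}∫_{B_q^n}⟨x,y⟩^2)/(|B_p^n||B_q^n|) equals (n/9)·∏_{k=1}^∞ (k^2+k+t)(k^2+(n+2)k+(n+2)^2 t) / ((k^2+3k+9t)(k^2+nk+n^2 t)). -/
open MeasureTheory Filter Finset
open scoped Pointwise

lemma one_dim (p : ℝ) (hp : 0 < p) (e : ℕ) :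
    Integrable (fun x : ℝ => |x| ^ e * Real.exp (-|x| ^ p)) ∧
    ∫ x : ℝ, |x| ^ e * Real.exp (-|x| ^ p) = 2 * (1 / p) * Real.Gamma ((e + 1) * (1 / p)) := by
  have he : (-1 : ℝ) < e := by have := Nat.cast_nonneg (α := ℝ) e; linarith
  have hv : ∫ x : ℝ, |x| ^ e * Real.exp (-|x| ^ p) =
      2 * (1 / p) * Real.Gamma ((e + 1) * (1 / p)) := by
    rw [integral_comp_abs (f := fun x => x ^ e * Real.exp (-x ^ p))]
    have h := integral_rpow_mul_exp_neg_rpow hp he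
    simp only [Real.rpow_natCast] at h
    rw [h, mul_one_div ((e : ℝ) + 1)]; ring
  refine ⟨Integrable.of_integral_ne_zero ?_, hv⟩
  rw [hv]
  have : 0 < Real.Gamma ((e + 1) * (1 / p)) := Real.Gamma_pos_of_pos (by positivity)
  positivity

lemma ball_smul (n : ℕ) (p : ℝ) (hp : 0 < p) (r : ℝ) (hr : 0 < r) :
    {x : Fin n → ℝ | ∑ i, |x i| ^ p ≤ r} =
      (r ^ (1 / p)) • {x : Fin n → ℝ | ∑ i, |x i| ^ p ≤ 1} := by
  have hc : 0 < r ^ (1 / p) := Real.rpow_pos_of_pos hr _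
  ext x
  rw [Set.mem_smul_set_iff_inv_smul_mem₀ hc.ne']
  simp only [Set.mem_ofPred_eq, Pi.smul_apply, smul_eq_mul, abs_mul, abs_inv, abs_of_pos hc]
  have : ∀ i, ((r ^ (1 / p))⁻¹ * |x i|) ^ p = r⁻¹ * |x i| ^ p := by
    intro i
    rw [Real.mul_rpow (by positivity) (by positivity), Real.inv_rpow hc.le, ← Real.rpow_mul hr.le,
      one_div_mul_cancel hp.ne', Real.rpow_one]
  simp only [this, ← Finset.mul_sum]
  rw [inv_mul_le_iff₀ hr, mul_one]

lemma exp_tail (c : ℝ) : Integrable ((Set.Ici c).indicator (fun r => Real.exp (-r))) ∧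
    ∫ r, (Set.Ici c).indicator (fun r => Real.exp (-r)) r = Real.exp (-c) := by
  constructor
  · rw [integrable_indicator_iff measurableSet_Ici, integrableOn_Ici_iff_integrableOn_Ioi]
    exact integrableOn_exp_neg_Ioi c
  · rw [integral_indicator measurableSet_Ici, integral_Ici_eq_integral_Ioi, integral_exp_neg_Ioi]

lemma moment (n : ℕ) (p : ℝ) (hp : 0 < p) (e : Fin n → ℕ) :
    Real.Gamma (1 + (n + ∑ i, (e i : ℝ)) * (1 / p)) *
      ∫ x in {x : Fin n → ℝ | ∑ i, |x i| ^ p ≤ 1}, ∏ i, |x i| ^ e i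
    = ∏ i, (2 * (1 / p) * Real.Gamma ((e i + 1) * (1 / p))) := by
  set g : (Fin n → ℝ) → ℝ := fun x => ∑ i, |x i| ^ p with hg
  set w : (Fin n → ℝ) → ℝ := fun x => ∏ i, |x i| ^ e i with hw
  have hgm : Measurable g := by fun_prop
  have hwm : Measurable w := by fun_prop
  have hg0 : ∀ x, 0 ≤ g x := fun x => Finset.sum_nonneg fun i _ => by positivity
  have hw0 : ∀ x, 0 ≤ w x := fun x => Finset.prod_nonneg fun i _ => by positivity
  have hprod : (fun x => w x * Real.exp (-g x)) =
      fun x : Fin n → ℝ => ∏ i, (|x i| ^ e i * Real.exp (-|x i| ^ p)) := by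
    ext x
    rw [Finset.prod_mul_distrib, ← Real.exp_sum, Finset.sum_neg_distrib]
  have hint : Integrable (fun x => w x * Real.exp (-g x)) := by
    rw [hprod]
    exact Integrable.fintype_prod (f := fun i (x : ℝ) => |x| ^ e i * Real.exp (-|x| ^ p))
      (fun i => (one_dim p hp (e i)).1)
  have hval : ∫ x, w x * Real.exp (-g x) =
      ∏ i, (2 * (1 / p) * Real.Gamma ((e i + 1) * (1 / p))) := by
    rw [hprod, integral_fintype_prod_volume_eq_prod
      (f := fun i (x : ℝ) => |x| ^ e i * Real.exp (-|x| ^ p))]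
    exact Finset.prod_congr rfl fun i _ => (one_dim p hp (e i)).2
  let F : (Fin n → ℝ) → ℝ → ℝ := fun x r =>
    w x * (Set.Ici (g x)).indicator (fun r => Real.exp (-r)) r
  have hFm : Measurable (Function.uncurry F) := by
    have : Function.uncurry F = {z : (Fin n → ℝ) × ℝ | g z.1 ≤ z.2}.indicator
        (fun z => w z.1 * Real.exp (-z.2)) := by
      ext ⟨x, r⟩
      simp only [Function.uncurry, F, Set.indicator, Set.mem_Ici, Set.mem_ofPred_eq]
      split_ifs <;> simp
    rw [this]
    exact Measurable.indicator (by fun_prop) (measurableSet_le (by fun_prop) (by fun_prop))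
  have hFx : ∀ x, ∫ r, F x r = w x * Real.exp (-g x) := fun x => by
    simp only [F, integral_const_mul, (exp_tail (g x)).2]
  have hF0 : ∀ x r, 0 ≤ F x r := fun x r =>
    mul_nonneg (hw0 x) (Set.indicator_nonneg (fun _ _ => (Real.exp_pos _).le) _)
  have hFint : Integrable (Function.uncurry F) (volume.prod volume) := by
    rw [integrable_prod_iff hFm.aestronglyMeasurable]
    constructor
    · exact Eventually.of_forall fun x => ((exp_tail (g x)).1).const_mul (w x)
    · refine hint.congr (Eventually.of_forall fun x => ?_)
      simp only [Function.uncurry, Real.norm_of_nonneg (hF0 _ _), hFx]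
  have hswap := integral_integral_swap hFint
  simp only [hFx] at hswap
  rw [hval] at hswap
  rw [hswap]
  have hr1 : ∀ r, ∫ x, F x r = Real.exp (-r) * ∫ x in {x | g x ≤ r}, w x := by
    intro r
    rw [← integral_const_mul, ← integral_indicator (measurableSet_le hgm measurable_const)]
    congr 1; ext x
    simp only [F, Set.indicator, Set.mem_Ici, Set.mem_ofPred_eq]
    split_ifs <;> ring
  simp only [hr1]
  have hr2 : ∀ r, r ∉ Set.Ici (0:ℝ) → Real.exp (-r) * ∫ x in {x | g x ≤ r}, w x = 0 := by
    intro r hr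
    have : {x | g x ≤ r} = ∅ := by
      ext x
      simp only [Set.mem_ofPred_eq, Set.mem_empty_iff_false, iff_false, not_le]
      exact (not_le.1 hr).trans_le (hg0 x)
    rw [this]; simp
  rw [← setIntegral_eq_integral_of_forall_compl_eq_zero hr2, integral_Ici_eq_integral_Ioi]
  have hr3 : ∀ r ∈ Set.Ioi (0:ℝ), Real.exp (-r) * ∫ x in {x | g x ≤ r}, w x =
      (Real.exp (-r) * r ^ ((1 + (n + ∑ i, (e i : ℝ)) * (1 / p)) - 1)) *
        ∫ x in {x | g x ≤ 1}, w x := by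
    intro r hr
    have hr : 0 < r := hr
    have hc : 0 < r ^ (1 / p) := Real.rpow_pos_of_pos hr _
    have h := Measure.setIntegral_comp_smul_of_pos volume w {x | g x ≤ 1} hc
    rw [← ball_smul n p hp r hr] at h
    have hww : ∀ x, w (r ^ (1 / p) • x) = (r ^ (1 / p)) ^ (∑ i, e i) * w x := by
      intro x
      simp only [w, Pi.smul_apply, smul_eq_mul, abs_mul, abs_of_pos hc, mul_pow,
        Finset.prod_mul_distrib, Finset.prod_pow_eq_pow_sum]
    simp only [hww, integral_const_mul, smul_eq_mul, Module.finrank_fin_fun] at h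
    rw [inv_mul_eq_div, eq_div_iff (by positivity)] at h
    rw [← h]
    have : r ^ ((1 + (n + ∑ i, (e i : ℝ)) * (1 / p)) - 1) =
        (r ^ (1 / p)) ^ (∑ i, e i) * (r ^ (1 / p)) ^ n := by
      rw [← pow_add, ← Real.rpow_natCast, ← Real.rpow_mul hr.le]
      congr 1; push_cast; ring
    rw [this]; ring
  rw [setIntegral_congr_fun measurableSet_Ioi hr3, integral_mul_const,
    ← Real.Gamma_eq_integral (by positivity)]

lemma lp_ball_sub (n : ℕ) (p : ℝ) (hp : 0 < p) {x : Fin n → ℝ}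
    (hx : x ∈ {x : Fin n → ℝ | ∑ i, |x i| ^ p ≤ 1}) (i : Fin n) : |x i| ≤ 1 := by
  have h1 : |x i| ^ p ≤ 1 := (Finset.single_le_sum (f := fun i => |x i| ^ p)
    (fun i _ => by positivity) (Finset.mem_univ i)).trans hx
  by_contra h
  exact absurd h1 (not_le.2 (Real.one_lt_rpow (not_le.1 h) hp))

lemma ball_meas (n : ℕ) (p : ℝ) : MeasurableSet {x : Fin n → ℝ | ∑ i, |x i| ^ p ≤ 1} :=
  measurableSet_le (by fun_prop) measurable_const

lemma ball_finite (n : ℕ) (p : ℝ) (hp : 0 < p) :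
    volume {x : Fin n → ℝ | ∑ i, |x i| ^ p ≤ 1} < ⊤ := by
  refine (measure_mono (t := Set.Icc (-1) 1) ?_).trans_lt isCompact_Icc.measure_lt_top
  intro x hx
  exact ⟨fun i => (abs_le.1 (lp_ball_sub n p hp hx i)).1, fun i => (abs_le.1 (lp_ball_sub n p hp hx i)).2⟩

lemma int_ij (n : ℕ) (p : ℝ) (hp : 0 < p) (i j : Fin n) :
    IntegrableOn (fun x : Fin n → ℝ => x i * x j) {x : Fin n → ℝ | ∑ i, |x i| ^ p ≤ 1} := by
  refine IntegrableOn.of_bound (ball_finite n p hp) (by fun_prop) 1 ?_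
  filter_upwards [ae_restrict_mem (ball_meas n p)] with x hx
  rw [Real.norm_eq_abs, abs_mul]
  exact mul_le_one₀ (lp_ball_sub n p hp hx i) (abs_nonneg _) (lp_ball_sub n p hp hx j)

lemma cross (n : ℕ) (p : ℝ) (i j : Fin n) (hij : i ≠ j) :
    ∫ x in {x : Fin n → ℝ | ∑ i, |x i| ^ p ≤ 1}, x i * x j = 0 := by
  let f : Fin n → ℝ → ℝ := fun k => if k = i then fun t => -t else id
  have hf : ∀ k, MeasurePreserving (f k) volume volume := by
    intro k
    by_cases h : k = i
    · simp only [f, h, if_true]; exact Measure.measurePreserving_neg volume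
    · simp only [f, h, if_false]; exact MeasurePreserving.id _
  have hmp : MeasurePreserving (fun (x : Fin n → ℝ) k => f k (x k)) volume volume :=
    volume_preserving_pi hf
  have hinv : Function.Involutive (fun (x : Fin n → ℝ) k => f k (x k)) := by
    intro x; ext k; simp only [f]; split_ifs <;> simp
  let T : (Fin n → ℝ) ≃ᵐ (Fin n → ℝ) :=
    ⟨hinv.toPerm, hmp.measurable, hmp.measurable⟩
  have h := hmp.setIntegral_preimage_emb T.measurableEmbedding (fun x => x i * x j)
    {x : Fin n → ℝ | ∑ i, |x i| ^ p ≤ 1}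
  have hpre : (fun (x : Fin n → ℝ) k => f k (x k)) ⁻¹' {x : Fin n → ℝ | ∑ i, |x i| ^ p ≤ 1} =
      {x : Fin n → ℝ | ∑ i, |x i| ^ p ≤ 1} := by
    ext x
    simp only [Set.mem_preimage, Set.mem_ofPred_eq]
    have : ∀ k, |f k (x k)| = |x k| := by
      intro k; simp only [f]; split_ifs <;> simp
    simp only [this]
  rw [hpre] at h
  have h2 : ∀ x : Fin n → ℝ, f i (x i) * f j (x j) = -(x i * x j) := by
    intro x; simp [f, hij.symm]
  simp only [h2, integral_neg] at h
  linarith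

lemma ball_vol (n : ℕ) (p : ℝ) (hp : 0 < p) :
    Real.Gamma (1 + n * (1 / p)) * (volume {x : Fin n → ℝ | ∑ i, |x i| ^ p ≤ 1}).toReal =
      (2 * (1 / p) * Real.Gamma (1 / p)) ^ n := by
  have h := moment n p hp (fun _ => 0)
  simpa [Measure.real] using h

lemma ball_sq (n : ℕ) (p : ℝ) (hp : 0 < p) (i : Fin n) :
    Real.Gamma (1 + (n + 2) * (1 / p)) *
      ∫ x in {x : Fin n → ℝ | ∑ i, |x i| ^ p ≤ 1}, x i * x i =
      (2 * (1 / p) * Real.Gamma (1 / p)) ^ n * (Real.Gamma (3 * (1 / p)) / Real.Gamma (1 / p)) := by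
  have h := moment n p hp (fun k => if k = i then 2 else 0)
  have h1 : ∀ x : Fin n → ℝ, ∏ k, |x k| ^ (if k = i then 2 else 0) = x i * x i := by
    intro x
    rw [Finset.prod_eq_single i]
    · simp [sq]
    · intro k _ hk; simp [hk]
    · simp
  simp only [h1] at h
  have h2 : ∑ k : Fin n, (((if k = i then 2 else 0 : ℕ)) : ℝ) = 2 := by simp
  rw [h2] at h
  rw [h]
  have hpos : 0 < Real.Gamma (1 / p) := Real.Gamma_pos_of_pos (by positivity)
  have h3 : ∀ k : Fin n, 2 * (1 / p) * Real.Gamma ((((if k = i then 2 else 0 : ℕ) : ℝ) + 1) * (1 / p))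
      = (2 * (1 / p) * Real.Gamma (1 / p)) *
        (if k = i then Real.Gamma (3 * (1 / p)) / Real.Gamma (1 / p) else 1) := by
    intro k
    split_ifs
    · norm_num; field_simp
    · simp
  simp only [h3, Finset.prod_mul_distrib, Finset.prod_const, Finset.prod_ite_eq', Finset.card_univ,
    Fintype.card_fin, Finset.mem_univ, if_true, mul_pow]

lemma sq_sum_int (n : ℕ) (q : ℝ) (hq : 0 < q) (x : Fin n → ℝ) :
    ∫ y in {y : Fin n → ℝ | ∑ i, |y i| ^ q ≤ 1}, (∑ i, x i * y i) ^ 2 =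
     ∑ i, (x i * x i) * ∫ y in {y : Fin n → ℝ | ∑ i, |y i| ^ q ≤ 1}, y i * y i := by
  have h : ∀ y : Fin n → ℝ, (∑ i, x i * y i) ^ 2 = ∑ i, ∑ j, (x i * x j) * (y i * y j) := by
    intro y
    rw [sq, Finset.sum_mul_sum]
    exact Finset.sum_congr rfl fun i _ => Finset.sum_congr rfl fun j _ => by ring
  simp only [h]
  rw [integral_finsetSum _ fun i _ => integrable_finsetSum _ fun j _ =>
    (int_ij n q hq i j).const_mul _]
  refine Finset.sum_congr rfl fun i _ => ?_
  rw [integral_finsetSum _ fun j _ => (int_ij n q hq i j).const_mul _]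
  simp only [integral_const_mul]
  rw [Finset.sum_eq_single i]
  · intro j _ hj; rw [cross n q i j hj.symm, mul_zero]
  · simp

lemma ratio (n : ℕ) (p q : ℝ) (hp : 0 < p) (hq : 0 < q) :
    (∫ x in {x : Fin n → ℝ | ∑ i, |x i| ^ p ≤ 1},
            ∫ y in {y : Fin n → ℝ | ∑ i, |y i| ^ q ≤ 1}, (∑ i, x i * y i) ^ 2) /
          ((volume {x : Fin n → ℝ | ∑ i, |x i| ^ p ≤ 1}).toReal *
            (volume {y : Fin n → ℝ | ∑ i, |y i| ^ q ≤ 1}).toReal) =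
    n * ((Real.Gamma (3 * (1 / p)) / Real.Gamma (1 / p)) *
       (Real.Gamma (1 + n * (1 / p)) / Real.Gamma (1 + (n + 2) * (1 / p)))) *
     ((Real.Gamma (3 * (1 / q)) / Real.Gamma (1 / q)) *
       (Real.Gamma (1 + n * (1 / q)) / Real.Gamma (1 + (n + 2) * (1 / q)))) := by
  have key : ∀ s : ℝ, 0 < s → 0 < (volume {x : Fin n → ℝ | ∑ i, |x i| ^ s ≤ 1}).toReal ∧ ∀ i,
      ∫ x in {x : Fin n → ℝ | ∑ i, |x i| ^ s ≤ 1}, x i * x i =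
      ((Real.Gamma (3 * (1 / s)) / Real.Gamma (1 / s)) *
       (Real.Gamma (1 + n * (1 / s)) / Real.Gamma (1 + (n + 2) * (1 / s)))) *
       (volume {x : Fin n → ℝ | ∑ i, |x i| ^ s ≤ 1}).toReal := by
    intro s hs
    have h1 : 0 < Real.Gamma (1 + n * (1 / s)) := Real.Gamma_pos_of_pos (by positivity)
    have h2 : 0 < Real.Gamma (1 + (n + 2) * (1 / s)) := Real.Gamma_pos_of_pos (by positivity)
    have h3 : 0 < Real.Gamma (1 / s) := Real.Gamma_pos_of_pos (by positivity)
    have hv := ball_vol n s hs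
    constructor
    · have : 0 < (2 * (1 / s) * Real.Gamma (1 / s)) ^ n := by positivity
      rw [← hv] at this
      exact pos_of_mul_pos_right this h1.le
    · intro i
      have h := ball_sq n s hs i
      rw [← hv] at h
      generalize (∫ x in {x : Fin n → ℝ | ∑ i, |x i| ^ s ≤ 1}, x i * x i) = I at *
      rw [mul_comm, ← eq_div_iff h2.ne'] at h
      rw [h]; ring
  obtain ⟨hvp, hp2⟩ := key p hp
  obtain ⟨hvq, hq2⟩ := key q hq
  simp only [sq_sum_int n q hq, hq2]
  rw [integral_finsetSum _ fun i _ => (int_ij n p hp i i).mul_const _]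
  simp only [integral_mul_const, hp2, Finset.sum_const, Finset.card_univ, Fintype.card_fin,
    nsmul_eq_mul]
  rw [div_eq_iff (by positivity)]
  ring

/-- Euler product factor. -/
noncomputable def gseq (x : ℝ) (N : ℕ) : ℝ := ∏ k ∈ Finset.Icc 1 N, ((k : ℝ) + x)

lemma gseq_tendsto (x : ℝ) (hx : 0 < x) :
    Tendsto (fun N : ℕ => gseq x N / ((N : ℝ) ^ x * N.factorial)) atTop
      (nhds (1 / Real.Gamma (1 + x))) := by
  have h := ((Real.GammaSeq_tendsto_Gamma x).inv₀ (Real.Gamma_pos_of_pos hx).ne').div_const x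
  have e : (Real.Gamma x)⁻¹ / x = 1 / Real.Gamma (1 + x) := by
    rw [add_comm, Real.Gamma_add_one hx.ne']
    have := (Real.Gamma_pos_of_pos hx).ne'
    field_simp
  rw [e] at h
  refine h.congr fun N => ?_
  have hs : ∏ j ∈ Finset.range (N + 1), (x + (j : ℝ)) = x * gseq x N := by
    unfold gseq
    induction N with
    | zero => simp
    | succ N ih =>
      rw [Finset.prod_range_succ, ih, Finset.prod_Icc_succ_top (by omega)]
      push_cast; ring
  rw [Real.GammaSeq, hs, inv_div]
  field_simp

theorem f_n_p_product (n : ℕ) (hn : 1 ≤ n) (p q : ℝ) (hp : 1 < p)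
    (hpq : 1 / p + 1 / q = 1) :
    Tendsto
      (fun N : ℕ => ((n : ℝ) / 9) * ∏ k ∈ Finset.Icc 1 N,
        ((k : ℝ) ^ 2 + k + 1 / (p * q)) *
            ((k : ℝ) ^ 2 + ((n : ℝ) + 2) * k + ((n : ℝ) + 2) ^ 2 * (1 / (p * q))) /
          ((((k : ℝ) ^ 2 + 3 * k + 9 * (1 / (p * q)))) *
            ((k : ℝ) ^ 2 + n * k + (n : ℝ) ^ 2 * (1 / (p * q)))))
      atTop
      (nhds
        ((∫ x in {x : Fin n → ℝ | ∑ i, |x i| ^ p ≤ 1},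
            ∫ y in {y : Fin n → ℝ | ∑ i, |y i| ^ q ≤ 1}, (∑ i, x i * y i) ^ 2) /
          ((volume {x : Fin n → ℝ | ∑ i, |x i| ^ p ≤ 1}).toReal *
            (volume {y : Fin n → ℝ | ∑ i, |y i| ^ q ≤ 1}).toReal))) := by
  have hp0 : 0 < p := by linarith
  have hp1 : 1 / p < 1 := by rw [div_lt_one hp0]; exact hp
  have hq0 : 0 < q := by
    have : 0 < 1 / q := by linarith
    exact one_div_pos.1 this
  rw [ratio n p q hp0 hq0]
  have hab : 1 / (p * q) = (1 / p) * (1 / q) := by field_simp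
  rw [hab]
  have ha : 0 < 1 / p := by positivity
  have hb : 0 < 1 / q := by positivity
  generalize 1 / p = a at *
  generalize 1 / q = b at *
  have hn0 : (0 : ℝ) < n := by exact_mod_cast hn
  have G : ∀ x : ℝ, 0 < x → 0 < Real.Gamma x := fun x hx => Real.Gamma_pos_of_pos hx
  have T : ∀ m : ℝ, 0 < m → Tendsto (fun N : ℕ => (gseq (m * a) N * gseq (m * b) N) /
      ((N : ℝ) ^ m * (N.factorial : ℝ) ^ 2)) atTop
      (nhds (1 / (Real.Gamma (1 + m * a) * Real.Gamma (1 + m * b)))) := by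
    intro m hm
    have h := (gseq_tendsto (m * a) (by positivity)).mul (gseq_tendsto (m * b) (by positivity))
    rw [one_div_mul_one_div] at h
    refine h.congr' ?_
    filter_upwards [eventually_gt_atTop 0] with N hN
    have hN : (0 : ℝ) < N := by exact_mod_cast hN
    have : (N : ℝ) ^ m = (N : ℝ) ^ (m * a) * (N : ℝ) ^ (m * b) := by
      rw [← Real.rpow_add hN, ← mul_add, hpq, mul_one]
    rw [this, div_mul_div_comm]; congr 1; ring
  have hne : ∀ m : ℝ, 0 < m → 1 / (Real.Gamma (1 + m * a) * Real.Gamma (1 + m * b)) ≠ 0 := by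
    intro m hm
    have h1 := G (1 + m * a) (by positivity)
    have h2 := G (1 + m * b) (by positivity)
    positivity
  have L := (((T 1 one_pos).mul (T (n + 2) (by positivity))).div
    ((T 3 (by norm_num)).mul (T n hn0)) (mul_ne_zero (hne 3 (by norm_num)) (hne n hn0))).const_mul
      ((n : ℝ) / 9)
  refine (L.congr' ?_).trans (le_of_eq ?_)
  · filter_upwards [eventually_gt_atTop 0] with N hN
    have hN : (0 : ℝ) < N := by exact_mod_cast hN
    have hf : (0 : ℝ) < N.factorial := by exact_mod_cast N.factorial_pos
    have hprod : ∏ k ∈ Finset.Icc 1 N, (((k : ℝ) ^ 2 + k + a * b) *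
            ((k : ℝ) ^ 2 + ((n : ℝ) + 2) * k + ((n : ℝ) + 2) ^ 2 * (a * b)) /
          ((((k : ℝ) ^ 2 + 3 * k + 9 * (a * b))) *
            ((k : ℝ) ^ 2 + n * k + (n : ℝ) ^ 2 * (a * b)))) =
        ((gseq (1 * a) N * gseq (1 * b) N) * (gseq ((n + 2) * a) N * gseq ((n + 2) * b) N)) /
        ((gseq (3 * a) N * gseq (3 * b) N) * (gseq (n * a) N * gseq (n * b) N)) := by
      simp only [gseq, ← Finset.prod_mul_distrib, ← Finset.prod_div_distrib]
      refine Finset.prod_congr rfl fun k _ => ?_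
      have key : ∀ m : ℝ, ((k : ℝ) + m * a) * (k + m * b) = (k : ℝ) ^ 2 + m * k + m ^ 2 * (a * b) := by
        intro m
        have : b = 1 - a := by linarith
        rw [this]; ring
      rw [key, key, key, key]; norm_num
    rw [hprod]
    have hpos : ∀ x : ℝ, 0 < x → 0 < gseq x N := fun x hx => Finset.prod_pos fun k _ => by positivity
    have h1 := hpos (3 * a) (by positivity)
    have h2 := hpos (3 * b) (by positivity)
    have h3 := hpos (n * a) (by positivity)
    have h4 := hpos (n * b) (by positivity)
    have e1 : (N : ℝ) ^ ((n : ℝ) + 2) = (N : ℝ) ^ (n : ℝ) * (N : ℝ) ^ (2:ℝ) := Real.rpow_add hN _ _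
    have e2 : (N : ℝ) ^ (3 : ℝ) = (N : ℝ) ^ (1 : ℝ) * (N : ℝ) ^ (2:ℝ) := by
      rw [← Real.rpow_add hN]; norm_num
    have q1 : 0 < (N : ℝ) ^ (n : ℝ) := Real.rpow_pos_of_pos hN _
    have q2 : 0 < (N : ℝ) ^ (2 : ℝ) := Real.rpow_pos_of_pos hN _
    have q3 : 0 < (N : ℝ) ^ (1 : ℝ) := Real.rpow_pos_of_pos hN _
    simp only [Pi.div_apply]
    rw [e1, e2]
    generalize (N : ℝ) ^ (n : ℝ) = A at *
    generalize (N : ℝ) ^ (2 : ℝ) = B at *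
    generalize (N : ℝ) ^ (1 : ℝ) = C at *
    field_simp
  · congr 1
    have g1 : ∀ c : ℝ, 0 < c → Real.Gamma (1 + c) = c * Real.Gamma c := fun c hc => by
      rw [add_comm, Real.Gamma_add_one hc.ne']
    rw [one_mul, one_mul, g1 a ha, g1 b hb, g1 (3 * a) (by positivity), g1 (3 * b) (by positivity)]
    have h1 := G a ha
    have h2 := G b hb
    have h3 := G (3 * a) (by positivity)
    have h4 := G (3 * b) (by positivity)
    have h5 := G (1 + n * a) (by positivity)
    have h6 := G (1 + n * b) (by positivity)
    have h7 := G (1 + (n + 2) * a) (by positivity)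
    have h8 := G (1 + (n + 2) * b) (by positivity)
    generalize Real.Gamma a = A at *
    generalize Real.Gamma b = B at *
    generalize Real.Gamma (3 * a) = A3 at *
    generalize Real.Gamma (3 * b) = B3 at *
    generalize Real.Gamma (1 + n * a) = A4 at *
    generalize Real.Gamma (1 + n * b) = B4 at *
    generalize Real.Gamma (1 + (n + 2) * a) = A5 at *
    generalize Real.Gamma (1 + (n + 2) * b) = B5 at *
    field_simp
    norm_num
end

section
/- For every integer n ≥ 2, every integer k ≥ 1, and every real t > 0, with g_k(m,t) = k^2 + mk + m^2 t, one has n^2·g_k(3,t)·g_k(n+2,t)·(g_k(n,t) − g_k(1,t)) + g_k(n,t)·((n+2)^2·g_k(1,t)·g_k(3,t) − 9·g_k(n+2,t)) > 0. -/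
/-- `g_k(m, t) = k² + m·k + m²·t`. -/
def g (k : ℕ) (m : ℝ) (t : ℝ) : ℝ := (k : ℝ) ^ 2 + m * k + m ^ 2 * t

theorem key_positivity (n k : ℕ) (hn : 2 ≤ n) (hk : 1 ≤ k) (t : ℝ) (ht : 0 < t) :
    0 < (n : ℝ) ^ 2 * g k 3 t * g k ((n : ℝ) + 2) t * (g k n t - g k 1 t) +
      g k n t * (((n : ℝ) + 2) ^ 2 * g k 1 t * g k 3 t - 9 * g k ((n : ℝ) + 2) t) := by
  obtain ⟨a, rfl⟩ := Nat.exists_eq_add_of_le hn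
  obtain ⟨b, rfl⟩ := Nat.exists_eq_add_of_le hk
  unfold g
  push_cast
  have ha : (0 : ℝ) ≤ a := Nat.cast_nonneg a
  have hb : (0 : ℝ) ≤ b := Nat.cast_nonneg b
  generalize (a : ℝ) = x at *
  generalize (b : ℝ) = y at *
  ring_nf
  positivity
end

section
/- Define F(t) = (n/9)·∏_{k=1}^∞ (k^2+k+t)(k^2+(n+2)k+(n+2)^2 t)/((k^2+3k+9t)(k^2+nk+n^2 t)) for t ∈ (0, 1/4] and fixed integer n ≥ 2. Then F is strictly increasing on (0, 1/4]. -/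
open Set MeasureTheory

lemma aux_r (v : ℝ) (hv : 0 < v) : 2 * (Real.exp v - 1) < v * (Real.exp v + 1) := by
  have hd : ∀ x : ℝ, HasDerivAt (fun x : ℝ => x * (Real.exp x + 1) - 2 * (Real.exp x - 1))
      (1 + x * Real.exp x - Real.exp x) x := by
    intro x
    have h := ((hasDerivAt_id x).mul ((Real.hasDerivAt_exp x).add_const 1)).sub
      (((Real.hasDerivAt_exp x).sub_const 1).const_mul 2)
    refine h.congr_deriv ?_
    simp; ring
  have hm : StrictMonoOn (fun x : ℝ => x * (Real.exp x + 1) - 2 * (Real.exp x - 1)) (Ici 0) := by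
    apply strictMonoOn_of_deriv_pos (convex_Ici 0)
    · exact fun x _ => (hd x).continuousAt.continuousWithinAt
    · intro x hx
      rw [interior_Ici, mem_Ioi] at hx
      rw [(hd x).deriv]
      have h1 := Real.add_one_lt_exp (x := -x) (by linarith)
      have h2 : Real.exp (-x) * Real.exp x = 1 := by rw [← Real.exp_add]; simp
      nlinarith [Real.exp_pos x]
  have := hm (mem_Ici.2 le_rfl) (mem_Ici.2 hv.le) hv
  simp at this
  linarith

lemma aux_E (u m : ℝ) (hu : 0 < u) (hm : 0 < m) : 0 < Real.exp (u / m) - 1 := by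
  have : 0 < u / m := by positivity
  linarith [Real.add_one_lt_exp this.ne']

lemma aux_convex (u : ℝ) (hu : 0 < u) :
    StrictConvexOn ℝ (Ioi 0) (fun m : ℝ => (Real.exp (u / m) - 1)⁻¹) := by
  have hv : ∀ m : ℝ, 0 < m → HasDerivAt (fun m : ℝ => u / m) (-u / m ^ 2) m := by
    intro m hm
    have := (hasDerivAt_const m u).div (hasDerivAt_id m) hm.ne'
    refine this.congr_deriv ?_
    simp
  have hE : ∀ m : ℝ, 0 < m → HasDerivAt (fun m : ℝ => Real.exp (u / m))
      (Real.exp (u / m) * (-u / m ^ 2)) m := fun m hm => (hv m hm).exp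
  have hd1 : ∀ m : ℝ, 0 < m → HasDerivAt (fun m : ℝ => (Real.exp (u / m) - 1)⁻¹)
      (u / m ^ 2 * Real.exp (u / m) / (Real.exp (u / m) - 1) ^ 2) m := by
    intro m hm
    refine (((hE m hm).sub_const 1).inv (aux_E u m hu hm).ne').congr_deriv ?_
    ring
  have hd2 : ∀ m : ℝ, 0 < m → HasDerivAt
      (fun m : ℝ => u / m ^ 2 * Real.exp (u / m) / (Real.exp (u / m) - 1) ^ 2)
      (u / m ^ 3 * Real.exp (u / m) / (Real.exp (u / m) - 1) ^ 3 *
        (u / m * (Real.exp (u / m) + 1) - 2 * (Real.exp (u / m) - 1))) m := by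
    intro m hm
    have hne := (aux_E u m hu hm).ne'
    have h1 : HasDerivAt (fun m : ℝ => u / m ^ 2) (-2 * u / m ^ 3) m := by
      refine ((hasDerivAt_const m u).div (hasDerivAt_pow 2 m) (by positivity)).congr_deriv ?_
      field_simp; simp; ring
    refine ((h1.mul (hE m hm)).div (((hE m hm).sub_const 1).pow 2) (pow_ne_zero _ hne)).congr_deriv ?_
    simp only [Pi.mul_apply, Pi.pow_apply]
    generalize Real.exp (u / m) = E at *
    field_simp
    ring
  apply strictConvexOn_of_deriv2_pos (convex_Ioi 0)
  · exact fun x hx => (hd1 x hx).continuousAt.continuousWithinAt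
  · intro m hm
    rw [interior_Ioi, mem_Ioi] at hm
    have he : deriv (fun m : ℝ => (Real.exp (u / m) - 1)⁻¹) =ᶠ[nhds m]
        (fun m : ℝ => u / m ^ 2 * Real.exp (u / m) / (Real.exp (u / m) - 1) ^ 2) := by
      filter_upwards [Ioi_mem_nhds hm] with x hx using (hd1 x hx).deriv
    simp only [Function.iterate_succ, Function.iterate_zero, Function.comp_apply, id]
    rw [he.deriv_eq, (hd2 m hm).deriv]
    have h1 := aux_E u m hu hm
    have h2 := aux_r (u / m) (by positivity)
    have h3 := Real.exp_pos (u / m)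
    have h4 : 0 < u / m * (Real.exp (u / m) + 1) - 2 * (Real.exp (u / m) - 1) := by linarith
    positivity

lemma aux_major (f : ℝ → ℝ) (hf : StrictConvexOn ℝ (Ioi 0) f) (n : ℝ) (hn : 2 ≤ n) :
    f 3 + f n < f 1 + f (n + 2) := by
  have hp : 0 < n + 1 := by linarith
  obtain ⟨_, hf⟩ := hf
  have h1 := hf (x := 1) (by simp) (y := n + 2) (by simp; linarith) (by linarith)
    (a := (n - 1) / (n + 1)) (b := 2 / (n + 1)) (div_pos (by linarith) hp) (by positivity)
    (by field_simp; ring)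
  have h2 := hf (x := 1) (by simp) (y := n + 2) (by simp; linarith) (by linarith)
    (a := 2 / (n + 1)) (b := (n - 1) / (n + 1)) (by positivity) (div_pos (by linarith) hp)
    (by field_simp; ring)
  have e1 : ((n - 1) / (n + 1)) • (1:ℝ) + (2 / (n + 1)) • (n + 2) = 3 := by
    simp only [smul_eq_mul]; field_simp; ring
  have e2 : (2 / (n + 1)) • (1:ℝ) + ((n - 1) / (n + 1)) • (n + 2) = n := by
    simp only [smul_eq_mul]; field_simp; ring
  rw [e1] at h1
  rw [e2] at h2
  simp only [smul_eq_mul] at h1 h2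
  have e3 : (n - 1) / (n + 1) = 1 - 2 / (n + 1) := by field_simp; ring
  rw [e3] at h1 h2
  linarith

lemma hasSum_recast {f g : ℕ → ℝ} {x y : ℝ} (h : HasSum f x) (hf : ∀ k, g k = f k) (hy : y = x) :
    HasSum g y := by
  have : g = f := funext hf
  rw [this, hy]; exact h

lemma aux_sq : Summable (fun k : ℕ => 1 / ((k : ℝ) + 1) ^ 2) := by
  have := (summable_nat_add_iff (f := fun k : ℕ => 1 / (k : ℝ) ^ 2) 1).2
    (Real.summable_one_div_nat_pow.2 (by norm_num))
  simpa using this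

lemma aux_intble (c : ℝ) (hc : 0 < c) : IntegrableOn (fun u : ℝ => Real.exp (-c * u)) (Ioi 0) :=
  integrableOn_exp_mul_Ioi (by linarith) 0

lemma aux_int (c : ℝ) (hc : 0 < c) : ∫ u in Ioi (0 : ℝ), Real.exp (-c * u) = 1 / c := by
  rw [integral_exp_mul_Ioi (by linarith) 0]
  simp

lemma aux_geom (u m : ℝ) (hu : 0 < u) (hm : 0 < m) :
    HasSum (fun k : ℕ => Real.exp (-(((k : ℝ) + 1) / m) * u)) (Real.exp (u / m) - 1)⁻¹ := by
  have hr : Real.exp (-(u / m)) < 1 := by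
    rw [Real.exp_lt_one_iff]
    have : 0 < u / m := by positivity
    linarith
  have h := (hasSum_geometric_of_lt_one (Real.exp_pos _).le hr).mul_left (Real.exp (-(u / m)))
  have hE := aux_E u m hu hm
  refine hasSum_recast h (fun k => ?_) ?_
  · rw [← Real.exp_nat_mul, ← Real.exp_add]
    congr 1
    field_simp
    ring
  · rw [Real.exp_neg]
    have := Real.exp_pos (u / m)
    field_simp

lemma aux_hasSum (a b m : ℝ) (ha : 0 < a) (hab : a < b) (hm : 0 < m) :
    HasSum (fun k : ℕ => 1 / (((k : ℝ) + 1) / m + a) - 1 / (((k : ℝ) + 1) / m + b))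
      (∫ u in Ioi (0 : ℝ), (Real.exp (-a * u) - Real.exp (-b * u)) * (Real.exp (u / m) - 1)⁻¹) := by
  set F : ℕ → ℝ → ℝ := fun k u =>
    Real.exp (-(((k : ℝ) + 1) / m + a) * u) - Real.exp (-(((k : ℝ) + 1) / m + b) * u) with hF
  have hxa : ∀ k : ℕ, 0 < ((k : ℝ) + 1) / m + a := fun k => by positivity
  have hb : 0 < b := by linarith
  have hxb : ∀ k : ℕ, 0 < ((k : ℝ) + 1) / m + b := fun k => by positivity
  have hint : ∀ k, Integrable (F k) (volume.restrict (Ioi 0)) := fun k =>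
    (aux_intble _ (hxa k)).sub (aux_intble _ (hxb k))
  have hval : ∀ k, ∫ u in Ioi (0 : ℝ), F k u =
      1 / (((k : ℝ) + 1) / m + a) - 1 / (((k : ℝ) + 1) / m + b) := by
    intro k
    rw [hF]
    simp only
    rw [integral_sub (aux_intble _ (hxa k)) (aux_intble _ (hxb k)), aux_int _ (hxa k),
      aux_int _ (hxb k)]
  have hnorm : ∀ k, ∫ u in Ioi (0 : ℝ), ‖F k u‖ = ∫ u in Ioi (0 : ℝ), F k u := by
    intro k
    apply setIntegral_congr_fun measurableSet_Ioi
    intro u hu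
    rw [mem_Ioi] at hu
    simp only [Real.norm_eq_abs]
    apply abs_of_nonneg
    simp only [hF, sub_nonneg, Real.exp_le_exp]
    nlinarith
  have hsum : Summable (fun k => ∫ u in Ioi (0 : ℝ), ‖F k u‖) := by
    simp_rw [hnorm, hval]
    refine Summable.of_nonneg_of_le (fun k => ?_) (fun k => ?_) (aux_sq.mul_left ((b - a) * m ^ 2))
    · rw [sub_nonneg]
      exact one_div_le_one_div_of_le (hxa k) (by linarith)
    · have hk : (0 : ℝ) < (k : ℝ) + 1 := by positivity
      have h1 := hxa k
      have h2 := hxb k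
      have hx : 0 < ((k : ℝ) + 1) / m := by positivity
      have e : (b - a) * m ^ 2 * (1 / ((k : ℝ) + 1) ^ 2) = (b - a) / (((k : ℝ) + 1) / m) ^ 2 := by
        field_simp
      rw [e]
      generalize ((k : ℝ) + 1) / m = x at *
      have e2 : 1 / (x + a) - 1 / (x + b) = (b - a) / ((x + a) * (x + b)) := by
        field_simp; ring
      rw [e2]
      apply div_le_div_of_nonneg_left (by linarith) (by positivity)
      nlinarith
  have h := hasSum_integral_of_summable_integral_norm hint hsum
  simp_rw [hval] at h
  refine hasSum_recast h (fun k => rfl) ?_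
  apply setIntegral_congr_fun measurableSet_Ioi
  intro u hu
  rw [mem_Ioi] at hu
  have h2 := (aux_geom u m hu hm).mul_left (Real.exp (-a * u) - Real.exp (-b * u))
  simp only
  rw [← h2.tsum_eq]
  congr 1
  funext k
  simp only [hF, sub_mul, ← Real.exp_add]
  congr 2 <;> ring

lemma aux_intG (a b m : ℝ) (ha : 0 < a) (hab : a < b) (hm : 0 < m) :
    IntegrableOn (fun u : ℝ => (Real.exp (-a * u) - Real.exp (-b * u)) * (Real.exp (u / m) - 1)⁻¹)
      (Ioi 0) := by
  refine Integrable.mono' ((aux_intble a ha).const_mul ((b - a) * m)) ?_ ?_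
  · apply Measurable.aestronglyMeasurable
    fun_prop
  · filter_upwards [self_mem_ae_restrict measurableSet_Ioi] with u hu
    rw [mem_Ioi] at hu
    have hE := aux_E u m hu hm
    have h1 : u / m ≤ Real.exp (u / m) - 1 := by linarith [Real.add_one_le_exp (u / m)]
    have h2 : (Real.exp (u / m) - 1)⁻¹ ≤ m / u := by
      have h0 := inv_anti₀ (by positivity) h1
      rwa [inv_div] at h0
    have h3 : Real.exp (-b * u) = Real.exp (-a * u) * Real.exp (-((b - a) * u)) := by
      rw [← Real.exp_add]; congr 1; ring
    have h4 : 1 - Real.exp (-((b - a) * u)) ≤ (b - a) * u := by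
      linarith [Real.add_one_le_exp (-((b - a) * u))]
    have h5 : 0 ≤ 1 - Real.exp (-((b - a) * u)) := by
      rw [sub_nonneg, Real.exp_le_one_iff]
      nlinarith
    have h6 := Real.exp_pos (-a * u)
    rw [h3, Real.norm_eq_abs, abs_of_nonneg]
    · calc _ = Real.exp (-a * u) * ((1 - Real.exp (-((b - a) * u))) * (Real.exp (u / m) - 1)⁻¹) := by
            ring
        _ ≤ Real.exp (-a * u) * ((b - a) * u * (m / u)) := by gcongr
        _ = _ := by field_simp
    · have : Real.exp (-a * u) - Real.exp (-a * u) * Real.exp (-((b - a) * u)) =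
        Real.exp (-a * u) * (1 - Real.exp (-((b - a) * u))) := by ring
      rw [this]; positivity

/-- sum of the derivatives is positive -/
lemma aux_pos (n a b : ℝ) (hn : 2 ≤ n) (ha : 0 < a) (hab : a < b) :
    ∃ S : ℝ, 0 < S ∧ HasSum (fun k : ℕ =>
      (1 / (((k : ℝ) + 1) / 1 + a) - 1 / (((k : ℝ) + 1) / 1 + b))
      + (1 / (((k : ℝ) + 1) / (n + 2) + a) - 1 / (((k : ℝ) + 1) / (n + 2) + b))
      - ((1 / (((k : ℝ) + 1) / 3 + a) - 1 / (((k : ℝ) + 1) / 3 + b))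
      + (1 / (((k : ℝ) + 1) / n + a) - 1 / (((k : ℝ) + 1) / n + b)))) S := by
  have p1 : (0:ℝ) < 1 := one_pos
  have p2 : (0:ℝ) < n + 2 := by linarith
  have p3 : (0:ℝ) < 3 := by norm_num
  have p4 : (0:ℝ) < n := by linarith
  refine ⟨_, ?_, ((aux_hasSum a b 1 ha hab p1).add (aux_hasSum a b (n + 2) ha hab p2)).sub
    ((aux_hasSum a b 3 ha hab p3).add (aux_hasSum a b n ha hab p4))⟩
  have i1 := aux_intG a b 1 ha hab p1
  have i2 := aux_intG a b (n + 2) ha hab p2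
  have i3 := aux_intG a b 3 ha hab p3
  have i4 := aux_intG a b n ha hab p4
  rw [← integral_add i1 i2, ← integral_add i3 i4, ← integral_sub (by exact i1.add i2) (by exact i3.add i4)]
  have key : ∀ u ∈ Ioi (0:ℝ), 0 <
      (Real.exp (-a * u) - Real.exp (-b * u)) * (Real.exp (u / 1) - 1)⁻¹
      + (Real.exp (-a * u) - Real.exp (-b * u)) * (Real.exp (u / (n + 2)) - 1)⁻¹
      - ((Real.exp (-a * u) - Real.exp (-b * u)) * (Real.exp (u / 3) - 1)⁻¹
      + (Real.exp (-a * u) - Real.exp (-b * u)) * (Real.exp (u / n) - 1)⁻¹) := by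
    intro u hu
    rw [mem_Ioi] at hu
    have h1 := aux_major _ (aux_convex u hu) n hn
    have h2 : 0 < Real.exp (-a * u) - Real.exp (-b * u) := by
      rw [sub_pos, Real.exp_lt_exp]; nlinarith
    nlinarith
  rw [setIntegral_pos_iff_support_of_nonneg_ae]
  · have : Ioi (0:ℝ) ⊆ Function.support (fun u : ℝ =>
      (Real.exp (-a * u) - Real.exp (-b * u)) * (Real.exp (u / 1) - 1)⁻¹
      + (Real.exp (-a * u) - Real.exp (-b * u)) * (Real.exp (u / (n + 2)) - 1)⁻¹
      - ((Real.exp (-a * u) - Real.exp (-b * u)) * (Real.exp (u / 3) - 1)⁻¹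
      + (Real.exp (-a * u) - Real.exp (-b * u)) * (Real.exp (u / n) - 1)⁻¹)) :=
      fun u hu => (key u hu).ne'
    rw [inter_eq_self_of_subset_right this]
    simp
  · filter_upwards [self_mem_ae_restrict measurableSet_Ioi] with u hu using (key u hu).le
  · exact (i1.add i2).sub (i3.add i4)

lemma aux_logderiv (x m t : ℝ) (hx : 0 < x) (hm : 0 < m) (ht : 0 < t) :
    HasDerivAt (fun t : ℝ => Real.log (x ^ 2 + m * x + m ^ 2 * t))
      (m ^ 2 / (x ^ 2 + m * x + m ^ 2 * t)) t := by
  have h : HasDerivAt (fun t : ℝ => x ^ 2 + m * x + m ^ 2 * t) (m ^ 2) t := by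
    simpa using ((hasDerivAt_id t).const_mul (m ^ 2)).const_add (x ^ 2 + m * x)
  exact h.log (by positivity)

lemma aux_bound (x m t : ℝ) (hx : 0 < x) (hm : 0 < m) (ht : 0 < t) :
    |m ^ 2 / (x ^ 2 + m * x + m ^ 2 * t)| ≤ m ^ 2 * (1 / x ^ 2) := by
  rw [abs_of_nonneg (by positivity), mul_one_div]
  apply div_le_div_of_nonneg_left (by positivity) (by positivity)
  have : 0 < m * x + m ^ 2 * t := by positivity
  linarith

lemma aux_pf (x m a b t : ℝ) (hx : 0 < x) (hm : 0 < m) (ha : 0 < a) (hab : a < b)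
    (h1 : a + b = 1) (h2 : a * b = t) :
    m ^ 2 / (x ^ 2 + m * x + m ^ 2 * t) = (1 / (x / m + a) - 1 / (x / m + b)) * (b - a)⁻¹ := by
  have hb : 0 < b := by linarith
  have e : x ^ 2 + m * x + m ^ 2 * t = (x + m * a) * (x + m * b) := by
    rw [← h2]; linear_combination (- m * x) * h1
  have e1 : x / m + a = (x + m * a) / m := by field_simp
  have e2 : x / m + b = (x + m * b) / m := by field_simp
  rw [e, e1, e2]
  have : b - a ≠ 0 := by linarith
  have p1 : 0 < x + m * a := by positivity
  have p2 : 0 < x + m * b := by positivity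
  field_simp
  ring

/-- the factor -/
noncomputable def fac (n x t : ℝ) : ℝ :=
  (x ^ 2 + x + t) * (x ^ 2 + (n + 2) * x + (n + 2) ^ 2 * t) /
    ((x ^ 2 + 3 * x + 9 * t) * (x ^ 2 + n * x + n ^ 2 * t))

/-- its logarithmic derivative -/
noncomputable def dfac (n x t : ℝ) : ℝ :=
  1 ^ 2 / (x ^ 2 + 1 * x + 1 ^ 2 * t) + (n + 2) ^ 2 / (x ^ 2 + (n + 2) * x + (n + 2) ^ 2 * t)
    - (3 ^ 2 / (x ^ 2 + 3 * x + 3 ^ 2 * t) + n ^ 2 / (x ^ 2 + n * x + n ^ 2 * t))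

lemma fac_pos (n x t : ℝ) (hn : 2 ≤ n) (hx : 0 < x) (ht : 0 < t) : 0 < fac n x t := by
  unfold fac
  positivity

lemma log_fac (n x t : ℝ) (hn : 2 ≤ n) (hx : 0 < x) (ht : 0 < t) :
    Real.log (fac n x t) = Real.log (x ^ 2 + 1 * x + 1 ^ 2 * t)
      + Real.log (x ^ 2 + (n + 2) * x + (n + 2) ^ 2 * t)
      - (Real.log (x ^ 2 + 3 * x + 3 ^ 2 * t) + Real.log (x ^ 2 + n * x + n ^ 2 * t)) := by
  have hn0 : 0 < n := by linarith
  unfold fac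
  rw [Real.log_div (by positivity) (by positivity), Real.log_mul (by positivity) (by positivity),
    Real.log_mul (by positivity) (by positivity)]
  norm_num

lemma fac_deriv (n x t : ℝ) (hn : 2 ≤ n) (hx : 0 < x) (ht : 0 < t) :
    HasDerivAt (fun t => Real.log (fac n x t)) (dfac n x t) t := by
  have hn0 : 0 < n := by linarith
  have h := ((aux_logderiv x 1 t hx one_pos ht).add (aux_logderiv x (n + 2) t hx (by linarith) ht)).sub
    ((aux_logderiv x 3 t hx (by norm_num) ht).add (aux_logderiv x n t hx hn0 ht))
  refine h.congr_of_eventuallyEq ?_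
  filter_upwards [Ioi_mem_nhds ht] with s hs
  exact log_fac n x s hn hx hs

lemma fac_summable (n : ℝ) (hn : 2 ≤ n) :
    Summable (fun k : ℕ => Real.log (fac n ((k : ℝ) + 1) (1 / 4))) := by
  have hn0 : 0 < n := by linarith
  have : Summable (fun k : ℕ => fac n ((k : ℝ) + 1) (1 / 4) - 1) := by
    refine Summable.of_norm_bounded (aux_sq.mul_left
      (n * (n + 2) * 100 + 100 + 100 * (n + 2) ^ 2)) (fun k => ?_)
    have hx : (1 : ℝ) ≤ (k : ℝ) + 1 := by simp
    generalize (k : ℝ) + 1 = x at *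
    have hx0 : 0 < x := by linarith
    have hd : 0 < (x ^ 2 + 3 * x + 9 * (1 / 4)) * (x ^ 2 + n * x + n ^ 2 * (1 / 4)) := by
      positivity
    have hd4 : x ^ 2 * x ^ 2 ≤ (x ^ 2 + 3 * x + 9 * (1 / 4)) * (x ^ 2 + n * x + n ^ 2 * (1 / 4)) := by
      apply mul_le_mul <;> nlinarith [mul_pos hn0 hx0, sq_nonneg n]
    rw [fac, div_sub_one hd.ne', Real.norm_eq_abs, abs_div, abs_of_pos hd,
      mul_one_div (n * (n + 2) * 100 + 100 + 100 * (n + 2) ^ 2), div_le_div_iff₀ hd (by positivity)]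
    have hnum : |(x ^ 2 + x + 1 / 4) * (x ^ 2 + (n + 2) * x + (n + 2) ^ 2 * (1 / 4)) -
        (x ^ 2 + 3 * x + 9 * (1 / 4)) * (x ^ 2 + n * x + n ^ 2 * (1 / 4))| ≤
        (n * (n + 2) * 100 + 100 + 100 * (n + 2) ^ 2) * x ^ 2 := by
      have hxx : x ≤ x ^ 2 := by nlinarith
      have hx1 : 1 ≤ x ^ 2 := by nlinarith
      have q1 := mul_le_mul_of_nonneg_left hxx hn0.le
      have q2 := mul_le_mul_of_nonneg_left hxx (sq_nonneg n)
      have q3 := mul_le_mul_of_nonneg_left hx1 hn0.le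
      have q4 := mul_le_mul_of_nonneg_left hx1 (sq_nonneg n)
      have q5 : 0 ≤ n * x := by positivity
      have q6 : 0 ≤ n ^ 2 * x := by positivity
      have q7 : 0 ≤ n ^ 2 := by positivity
      rw [abs_le]
      constructor <;> nlinarith
    calc _ ≤ ((n * (n + 2) * 100 + 100 + 100 * (n + 2) ^ 2) * x ^ 2) * x ^ 2 := by gcongr
      _ = (n * (n + 2) * 100 + 100 + 100 * (n + 2) ^ 2) * (x ^ 2 * x ^ 2) := by ring
      _ ≤ _ := by gcongr
  simpa using Real.summable_log_one_add_of_summable this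

lemma dfac_bound (n : ℝ) (hn : 2 ≤ n) : ∀ (k : ℕ) (y : ℝ), y ∈ Ioi (0:ℝ) → ‖dfac n ((k : ℝ) + 1) y‖ ≤
      (1 ^ 2 + (n + 2) ^ 2 + (3 ^ 2 + n ^ 2)) * (1 / ((k : ℝ) + 1) ^ 2) := by
  have hn0 : 0 < n := by linarith
  intro k y hy
  have hx : (0:ℝ) < (k : ℝ) + 1 := by positivity
  have h1 := abs_le.1 (aux_bound _ 1 y hx one_pos hy)
  have h2 := abs_le.1 (aux_bound _ (n + 2) y hx (by linarith) hy)
  have h3 := abs_le.1 (aux_bound _ 3 y hx (by norm_num) hy)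
  have h4 := abs_le.1 (aux_bound _ n y hx hn0 hy)
  rw [Real.norm_eq_abs, abs_le, dfac]
  constructor <;> linarith [h1.1, h1.2, h2.1, h2.2, h3.1, h3.2, h4.1, h4.2]

lemma aux_tsum (g g' : ℕ → ℝ → ℝ) (u : ℕ → ℝ) (hu : Summable u)
    (hd : ∀ (k : ℕ) (y : ℝ), y ∈ Ioi (0:ℝ) → HasDerivAt (g k) (g' k y) y)
    (hb : ∀ (k : ℕ) (y : ℝ), y ∈ Ioi (0:ℝ) → ‖g' k y‖ ≤ u k) (t₀ : ℝ) (h0 : 0 < t₀)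
    (hs : Summable (fun k => g k t₀)) (t : ℝ) (ht : 0 < t) :
    Summable (fun k => g k t) ∧ HasDerivAt (fun t => ∑' k, g k t) (∑' k, g' k t) t :=
  ⟨summable_of_summable_hasDerivAt_of_isPreconnected hu isOpen_Ioi isPreconnected_Ioi hd hb
    (mem_Ioi.2 h0) hs (mem_Ioi.2 ht),
    hasDerivAt_tsum_of_isPreconnected hu isOpen_Ioi isPreconnected_Ioi hd hb (mem_Ioi.2 h0) hs
      (mem_Ioi.2 ht)⟩

lemma fac_tsum_deriv (n t : ℝ) (hn : 2 ≤ n) (ht : 0 < t) :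
    Summable (fun k : ℕ => Real.log (fac n ((k : ℝ) + 1) t)) ∧
    HasDerivAt (fun t => ∑' k : ℕ, Real.log (fac n ((k : ℝ) + 1) t))
      (∑' k : ℕ, dfac n ((k : ℝ) + 1) t) t := by
  have hn0 : 0 < n := by linarith
  have hu := aux_sq.mul_left (1 ^ 2 + (n + 2) ^ 2 + (3 ^ 2 + n ^ 2))
  have hd : ∀ (k : ℕ) (y : ℝ), y ∈ Ioi (0:ℝ) →
      HasDerivAt (fun t => Real.log (fac n ((k : ℝ) + 1) t)) (dfac n ((k : ℝ) + 1) y) y :=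
    fun k y hy => fac_deriv n _ y hn (by positivity) hy
  have hb := dfac_bound n hn
  exact aux_tsum (fun k t => Real.log (fac n ((k : ℝ) + 1) t)) (fun k t => dfac n ((k : ℝ) + 1) t)
    _ hu hd hb (1 / 4) (by norm_num) (fac_summable n hn) t ht

lemma dfac_pos (n t : ℝ) (hn : 2 ≤ n) (ht : 0 < t) (ht4 : t < 1 / 4) :
    0 < ∑' k : ℕ, dfac n ((k : ℝ) + 1) t := by
  have hn0 : 0 < n := by linarith
  set s := Real.sqrt (1 - 4 * t) with hs
  have hs2 : s ^ 2 = 1 - 4 * t := Real.sq_sqrt (by linarith)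
  have hs0 : 0 < s := Real.sqrt_pos.2 (by linarith)
  have hs1 : s < 1 := by nlinarith
  have ha : 0 < (1 - s) / 2 := by linarith
  have hab : (1 - s) / 2 < (1 + s) / 2 := by linarith
  have e1 : (1 - s) / 2 + (1 + s) / 2 = 1 := by ring
  have e2 : (1 - s) / 2 * ((1 + s) / 2) = t := by linear_combination (-1/4) * hs2
  obtain ⟨S, hS, hsum⟩ := aux_pos n _ _ hn ha hab
  have h := hsum.mul_right ((1 + s) / 2 - (1 - s) / 2)⁻¹
  have : HasSum (fun k : ℕ => dfac n ((k : ℝ) + 1) t) (S * ((1 + s) / 2 - (1 - s) / 2)⁻¹) := by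
    refine hasSum_recast h (fun k => ?_) rfl
    have hx : (0:ℝ) < (k : ℝ) + 1 := by positivity
    rw [dfac, aux_pf _ 1 _ _ t hx one_pos ha hab e1 e2,
      aux_pf _ (n + 2) _ _ t hx (by linarith) ha hab e1 e2,
      aux_pf _ 3 _ _ t hx (by norm_num) ha hab e1 e2, aux_pf _ n _ _ t hx hn0 ha hab e1 e2]
    ring
  rw [this.tsum_eq]
  exact mul_pos hS (inv_pos.2 (by linarith))

theorem F_strictMono (n : ℕ) (hn : 2 ≤ n) :
    StrictMonoOn
      (fun t : ℝ => ((n : ℝ) / 9) * ∏' k : ℕ,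
        (((k : ℝ) + 1) ^ 2 + ((k : ℝ) + 1) + t) *
            (((k : ℝ) + 1) ^ 2 + ((n : ℝ) + 2) * ((k : ℝ) + 1) + ((n : ℝ) + 2) ^ 2 * t) /
          ((((k : ℝ) + 1) ^ 2 + 3 * ((k : ℝ) + 1) + 9 * t) *
            (((k : ℝ) + 1) ^ 2 + (n : ℝ) * ((k : ℝ) + 1) + (n : ℝ) ^ 2 * t)))
      (Set.Ioc 0 (1 / 4)) := by
  have hn' : (2 : ℝ) ≤ (n : ℝ) := by exact_mod_cast hn
  have hm : StrictMonoOn (fun t : ℝ => ∑' k : ℕ, Real.log (fac n ((k : ℝ) + 1) t))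
      (Set.Ioc 0 (1 / 4)) := by
    apply strictMonoOn_of_deriv_pos (convex_Ioc _ _)
    · exact fun t ht => (fac_tsum_deriv n t hn' ht.1).2.continuousAt.continuousWithinAt
    · intro t ht
      rw [interior_Ioc] at ht
      rw [(fac_tsum_deriv n t hn' ht.1).2.deriv]
      exact dfac_pos n t hn' ht.1 ht.2
  intro s hs t ht hst
  have hp : ∀ r ∈ Set.Ioc (0:ℝ) (1 / 4), ∏' k : ℕ, fac n ((k : ℝ) + 1) r =
      Real.exp (∑' k : ℕ, Real.log (fac n ((k : ℝ) + 1) r)) := fun r hr =>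
    (Real.rexp_tsum_eq_tprod (fun k => fac_pos n _ r hn' (by positivity) hr.1)
      (fac_tsum_deriv n r hn' hr.1).1).symm
  change (n : ℝ) / 9 * ∏' k : ℕ, fac n ((k : ℝ) + 1) s < (n : ℝ) / 9 * ∏' k : ℕ, fac n ((k : ℝ) + 1) t
  rw [hp s hs, hp t ht]
  have := hm hs ht hst
  have hn0 : (0:ℝ) < (n : ℝ) / 9 := by linarith
  exact mul_lt_mul_of_pos_left (Real.exp_lt_exp.2 this) hn0
end

section
/- For every 1 < p < ∞ with conjugate q = p/(p−1) and every integer n ≥ 1, n·Γ(3/p)Γ(3/q)Γ(1+n/p)Γ(1+n/q) / (Γ(1/p)Γ(1/q)Γ(1+(n+2)/p)Γ(1+(n+2)/q)) ≤ n/(n+2)^2. -/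
open MeasureTheory Set Filter Topology

lemma frul_int {a b : ℝ} (ha : 0 < a) (hab : a ≤ b) :
    IntegrableOn (fun u : ℝ => u⁻¹ * (Real.exp (-(a * u)) - Real.exp (-(b * u)))) (Ioi 0) := by
  have h1 : IntegrableOn (fun u : ℝ => (b - a) * Real.exp (-a * u)) (Ioi 0) :=
    (integrableOn_exp_mul_Ioi (neg_lt_zero.2 ha) 0).const_mul _
  refine Integrable.mono' h1 (by fun_prop) ?_
  refine (ae_restrict_iff' measurableSet_Ioi).2 (Eventually.of_forall fun u hu => ?_)
  have hu : 0 < u := hu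
  have h2 : Real.exp (-(b * u)) ≤ Real.exp (-(a * u)) := by
    apply Real.exp_le_exp.2; nlinarith
  rw [Real.norm_of_nonneg (mul_nonneg (by positivity) (by linarith))]
  rw [inv_mul_le_iff₀ hu]
  have h3 : Real.exp (-(b * u)) = Real.exp (-(a * u)) * Real.exp (-((b - a) * u)) := by
    rw [← Real.exp_add]; congr 1; ring
  have h4 := Real.add_one_le_exp (-((b - a) * u))
  have h5 := Real.exp_pos (-(a * u))
  rw [h3, neg_mul]
  nlinarith

lemma frul {a b : ℝ} (ha : 0 < a) (hab : a ≤ b) :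
    ∫ u in Ioi (0:ℝ), u⁻¹ * (Real.exp (-(a * u)) - Real.exp (-(b * u))) = Real.log (b / a) := by
  have hc : Continuous (fun u : ℝ => Real.exp (-u)) := by fun_prop
  have := Frullani.integral_Ioi_eq (f := fun u : ℝ => Real.exp (-u)) (a := a) (b := b) (L := 1)
    (R := 0) (hc.locallyIntegrable.locallyIntegrableOn _) ha (ha.trans_le hab)
    (by
      have h := hc.tendsto 0
      simp only [neg_zero, Real.exp_zero] at h
      exact h.mono_left nhdsWithin_le_nhds)
    Real.tendsto_exp_neg_atTop_nhds_zero (frul_int ha hab)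
  simpa using this

noncomputable def KK (n u : ℝ) : ℝ :=
  u⁻¹ * ((Real.exp (-u) - Real.exp (-(n * u))) * (1 - Real.exp (-(2 * u))))

lemma KK_nonneg {n u : ℝ} (hn : 1 ≤ n) (hu : 0 < u) : 0 ≤ KK n u := by
  unfold KK
  have h2 : Real.exp (-(n * u)) ≤ Real.exp (-u) := by
    apply Real.exp_le_exp.2; nlinarith
  have h3 : Real.exp (-(2 * u)) ≤ 1 := by
    apply Real.exp_le_one_iff.2; linarith
  exact mul_nonneg (by positivity) (mul_nonneg (by linarith) (by linarith))

noncomputable def phi (n v : ℝ) : ℝ :=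
  Real.log (3 + v) + Real.log (n + v) - Real.log (1 + v) - Real.log (n + 2 + v)

lemma KK_eq (n u v : ℝ) : KK n u * Real.exp (-(u * v)) =
    u⁻¹ * (Real.exp (-((1 + v) * u)) - Real.exp (-((3 + v) * u))) -
    u⁻¹ * (Real.exp (-((n + v) * u)) - Real.exp (-((n + 2 + v) * u))) := by
  have e1 : Real.exp (-((1 + v) * u)) = Real.exp (-u) * Real.exp (-(u * v)) := by
    rw [← Real.exp_add]; congr 1; ring
  have e2 : Real.exp (-((3 + v) * u)) =
      Real.exp (-u) * Real.exp (-(2 * u)) * Real.exp (-(u * v)) := by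
    rw [← Real.exp_add, ← Real.exp_add]; congr 1; ring
  have e3 : Real.exp (-((n + v) * u)) = Real.exp (-(n * u)) * Real.exp (-(u * v)) := by
    rw [← Real.exp_add]; congr 1; ring
  have e4 : Real.exp (-((n + 2 + v) * u)) =
      Real.exp (-(n * u)) * Real.exp (-(2 * u)) * Real.exp (-(u * v)) := by
    rw [← Real.exp_add, ← Real.exp_add]; congr 1; ring
  rw [e1, e2, e3, e4, KK]; ring

lemma phi_integral {n v : ℝ} (hn : 1 ≤ n) (hv : 0 ≤ v) :
    IntegrableOn (fun u => KK n u * Real.exp (-(u * v))) (Ioi 0) ∧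
    ∫ u in Ioi (0:ℝ), KK n u * Real.exp (-(u * v)) = phi n v := by
  simp_rw [KK_eq]
  have i1 := frul_int (a := 1 + v) (b := 3 + v) (by linarith) (by linarith)
  have i2 := frul_int (a := n + v) (b := n + 2 + v) (by linarith) (by linarith)
  refine ⟨i1.sub i2, ?_⟩
  rw [integral_sub i1 i2, frul (by linarith) (by linarith), frul (by linarith) (by linarith),
    Real.log_div (by linarith) (by linarith), Real.log_div (by linarith) (by linarith), phi]
  ring

lemma phi_nonneg {n v : ℝ} (hn : 1 ≤ n) (hv : 0 ≤ v) : 0 ≤ phi n v := by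
  rw [← (phi_integral hn hv).2]
  exact setIntegral_nonneg measurableSet_Ioi fun u hu =>
    mul_nonneg (KK_nonneg hn hu) (Real.exp_pos _).le

lemma phi_lintegral {n v : ℝ} (hn : 1 ≤ n) (hv : 0 ≤ v) :
    ENNReal.ofReal (phi n v) =
      ∫⁻ u in Ioi (0:ℝ), ENNReal.ofReal (KK n u * Real.exp (-(u * v))) := by
  rw [← (phi_integral hn hv).2]
  refine ofReal_integral_eq_lintegral_ofReal (phi_integral hn hv).1 ?_
  exact (ae_restrict_iff' measurableSet_Ioi).2 (Eventually.of_forall fun u hu =>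
    mul_nonneg (KK_nonneg hn hu) (Real.exp_pos _).le)

noncomputable def SS (n x : ℝ) : ℝ :=
  Real.log (Real.Gamma x) + Real.log (Real.Gamma ((n + 2) * x))
    - Real.log (Real.Gamma (3 * x)) - Real.log (Real.Gamma (n * x))

lemma phi_hasSum {n x : ℝ} (hn : 1 ≤ n) (hx : 0 < x) :
    HasSum (fun m : ℕ => phi n (m / x)) (SS n x) := by
  rw [hasSum_iff_tendsto_nat_of_nonneg (fun m => phi_nonneg hn (by positivity)),
    ← tendsto_add_atTop_iff_nat 1]
  have h1 := Real.BohrMollerup.tendsto_log_gamma hx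
  have h2 := Real.BohrMollerup.tendsto_log_gamma (x := (n + 2) * x) (by positivity)
  have h3 := Real.BohrMollerup.tendsto_log_gamma (x := 3 * x) (by positivity)
  have h4 := Real.BohrMollerup.tendsto_log_gamma (x := n * x) (by positivity)
  refine (((h1.add h2).sub h3).sub h4).congr fun N => ?_
  have key : ∀ m : ℕ, phi n (m / x) = Real.log (3 * x + m) + Real.log (n * x + m)
      - Real.log (x + m) - Real.log ((n + 2) * x + m) := by
    intro m
    have e : ∀ c : ℝ, 0 < c → Real.log (c + m / x) = Real.log (c * x + m) - Real.log x := by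
      intro c hc
      rw [← Real.log_div (by positivity) hx.ne']
      congr 1; field_simp
    rw [phi, e 3 (by norm_num), e n (by linarith), e 1 (by norm_num), e (n + 2) (by linarith)]
    ring_nf
  simp_rw [key, Real.BohrMollerup.logGammaSeq, Finset.sum_sub_distrib, Finset.sum_add_distrib]
  ring

lemma SS_nonneg {n x : ℝ} (hn : 1 ≤ n) (hx : 0 < x) : 0 ≤ SS n x :=
  (phi_hasSum hn hx).nonneg fun m => phi_nonneg hn (by positivity)

lemma SS_lintegral {n x : ℝ} (hn : 1 ≤ n) (hx : 0 < x) :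
    ENNReal.ofReal (SS n x) =
      ∫⁻ u in Ioi (0:ℝ), ENNReal.ofReal (KK n u * (1 - Real.exp (-(u / x)))⁻¹) := by
  rw [← (phi_hasSum hn hx).tsum_eq, ENNReal.ofReal_tsum_of_nonneg
    (fun m => phi_nonneg hn (by positivity)) (phi_hasSum hn hx).summable]
  have : ∀ m : ℕ, ENNReal.ofReal (phi n (m / x)) = _ :=
    fun m => phi_lintegral hn (by positivity)
  simp_rw [this]
  rw [← lintegral_tsum]
  · refine setLIntegral_congr_fun measurableSet_Ioi fun u hu => ?_
    have hu : 0 < u := hu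
    have hlt : Real.exp (-(u / x)) < 1 := Real.exp_lt_one_iff.2 (by
      have : 0 < u / x := by positivity
      linarith)
    have hg := (hasSum_geometric_of_lt_one (Real.exp_pos _).le hlt).mul_left (KK n u)
    have hh : ∀ m : ℕ, KK n u * Real.exp (-(u * (m / x))) =
        KK n u * Real.exp (-(u / x)) ^ m := by
      intro m
      rw [← Real.exp_nat_mul]
      congr 2; ring
    simp only [hh]
    rw [← hg.tsum_eq, ENNReal.ofReal_tsum_of_nonneg _ hg.summable]
    intro m
    exact mul_nonneg (KK_nonneg hn hu) (by positivity)
  · intro m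
    exact ((phi_integral hn (by positivity)).1.1.aemeasurable).ennreal_ofReal

lemma sinh_le_mul_cosh {z : ℝ} (hz : 0 ≤ z) : Real.sinh z ≤ z * Real.cosh z := by
  have hd : ∀ x : ℝ, HasDerivAt (fun x => x * Real.cosh x - Real.sinh x) (x * Real.sinh x) x := by
    intro x
    have := ((hasDerivAt_id x).mul (Real.hasDerivAt_cosh x)).sub (Real.hasDerivAt_sinh x)
    refine HasDerivAt.congr_deriv this ?_
    simp
  have hm : MonotoneOn (fun x => x * Real.cosh x - Real.sinh x) (Ici 0) := by
    refine monotoneOn_of_deriv_nonneg (convex_Ici 0)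
      (fun x _ => (hd x).continuousAt.continuousWithinAt)
      (fun x _ => (hd x).differentiableAt.differentiableWithinAt) ?_
    intro x hx
    rw [interior_Ici] at hx
    rw [(hd x).deriv]
    exact mul_nonneg (le_of_lt hx) (Real.sinh_nonneg_iff.2 (le_of_lt hx))
  have := hm (self_mem_Ici) (mem_Ici.2 hz) hz
  simp at this
  linarith

lemma xcoth_convex : ConvexOn ℝ (Ioi (0:ℝ)) (fun z => z * Real.cosh z / Real.sinh z) := by
  have hs : ∀ z ∈ Ioi (0:ℝ), Real.sinh z ≠ 0 := fun z hz => (Real.sinh_pos_iff.2 hz).ne'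
  have d1 : ∀ z ∈ Ioi (0:ℝ), HasDerivAt (fun z => z * Real.cosh z / Real.sinh z)
      ((Real.sinh z * Real.cosh z - z) / Real.sinh z ^ 2) z := by
    intro z hz
    have := ((hasDerivAt_id z).mul (Real.hasDerivAt_cosh z)).div (Real.hasDerivAt_sinh z) (hs z hz)
    refine HasDerivAt.congr_deriv this ?_
    simp
    congr 1
    linear_combination (-z) * Real.cosh_sq_sub_sinh_sq z
  have d2 : ∀ z ∈ Ioi (0:ℝ), HasDerivAt
      (fun z => (Real.sinh z * Real.cosh z - z) / Real.sinh z ^ 2)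
      (2 * (z * Real.cosh z - Real.sinh z) / Real.sinh z ^ 3) z := by
    intro z hz
    have h0 := hs z hz
    have := (((Real.hasDerivAt_sinh z).mul (Real.hasDerivAt_cosh z)).sub (hasDerivAt_id z)).div
      ((Real.hasDerivAt_sinh z).pow 2) (pow_ne_zero 2 h0)
    refine HasDerivAt.congr_deriv this ?_
    simp
    field_simp
    linear_combination (-Real.sinh z) * Real.cosh_sq_sub_sinh_sq z
  refine convexOn_of_hasDerivWithinAt2_nonneg (convex_Ioi 0)
    (fun z hz => (d1 z hz).continuousAt.continuousWithinAt)
    (f' := fun z => (Real.sinh z * Real.cosh z - z) / Real.sinh z ^ 2)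
    (f'' := fun z => 2 * (z * Real.cosh z - Real.sinh z) / Real.sinh z ^ 3) ?_ ?_ ?_
  · intro z hz; exact (d1 z (interior_subset hz)).hasDerivWithinAt
  · intro z hz; exact (d2 z (interior_subset hz)).hasDerivWithinAt
  · intro z hz
    have hz : 0 < z := interior_subset hz
    have := sinh_le_mul_cosh hz.le
    have := Real.sinh_pos_iff.2 hz
    exact div_nonneg (by linarith) (by positivity)

lemma inv_eq_coth {z : ℝ} (hz : 0 < z) :
    (1 - Real.exp (-(2 * z)))⁻¹ = (1 + Real.cosh z / Real.sinh z) / 2 := by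
  have h1 : Real.sinh z ≠ 0 := (Real.sinh_pos_iff.2 hz).ne'
  have h2 : 1 - Real.exp (-(2 * z)) ≠ 0 := by
    have : Real.exp (-(2 * z)) < 1 := Real.exp_lt_one_iff.2 (by linarith)
    linarith
  have h3 : Real.exp (-(2 * z)) = Real.exp (-z) * Real.exp (-z) := by
    rw [← Real.exp_add]; congr 1; ring
  have h4 : Real.exp z * Real.exp (-z) = 1 := by rw [← Real.exp_add]; simp
  rw [inv_eq_iff_eq_inv, eq_comm, inv_eq_iff_eq_inv, eq_comm, inv_eq_one_div,
    div_eq_iff h2]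
  field_simp
  rw [h3, Real.sinh_eq, Real.cosh_eq]
  linear_combination (Real.exp (-z)) * h4

lemma pointwise {u x y : ℝ} (hu : 0 < u) (hx : 0 < x) (hy : 0 < y) (hxy : x + y = 1) :
    2 * (1 - Real.exp (-(u / (1 / 2))))⁻¹ ≤
      (1 - Real.exp (-(u / x)))⁻¹ + (1 - Real.exp (-(u / y)))⁻¹ := by
  have e1 : u / (1 / 2) = 2 * u := by ring
  have e2 : u / x = 2 * (u / (2 * x)) := by field_simp
  have e3 : u / y = 2 * (u / (2 * y)) := by field_simp
  have p2 : 0 < u / (2 * x) := by positivity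
  have p3 : 0 < u / (2 * y) := by positivity
  rw [e1, e2, e3, inv_eq_coth hu, inv_eq_coth p2, inv_eq_coth p3]
  have := xcoth_convex.2 (mem_Ioi.2 p2) (mem_Ioi.2 p3) hx.le hy.le hxy
  simp only [smul_eq_mul] at this
  have e4 : x * (u / (2 * x)) + y * (u / (2 * y)) = u := by field_simp; ring
  rw [e4] at this
  have e5 : x * (u / (2 * x) * Real.cosh (u / (2 * x)) / Real.sinh (u / (2 * x)))
    = u * ((Real.cosh (u / (2 * x)) / Real.sinh (u / (2 * x))) / 2) := by
    generalize Real.cosh (u / (2 * x)) = c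
    generalize Real.sinh (u / (2 * x)) = s
    field_simp
  have e6 : y * (u / (2 * y) * Real.cosh (u / (2 * y)) / Real.sinh (u / (2 * y)))
    = u * ((Real.cosh (u / (2 * y)) / Real.sinh (u / (2 * y))) / 2) := by
    generalize Real.cosh (u / (2 * y)) = c
    generalize Real.sinh (u / (2 * y)) = s
    field_simp
  rw [e5, e6, mul_div_assoc, ← mul_add] at this
  have := le_of_mul_le_mul_left this hu
  linarith

lemma SS_ineq {n x y : ℝ} (hn : 1 ≤ n) (hx : 0 < x) (hy : 0 < y) (hxy : x + y = 1) :
    2 * SS n (1 / 2) ≤ SS n x + SS n y := by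
  have hh : (0:ℝ) < 1 / 2 := by norm_num
  have sx := SS_nonneg hn hx
  have sy := SS_nonneg hn hy
  have hm : ∀ z : ℝ, Measurable fun u =>
      ENNReal.ofReal (KK n u * (1 - Real.exp (-(u / z)))⁻¹) := by
    intro z; unfold KK; fun_prop
  have hpos : ∀ u z : ℝ, 0 < u → 0 < z → 0 ≤ KK n u * (1 - Real.exp (-(u / z)))⁻¹ := by
    intro u z hu hz
    refine mul_nonneg (KK_nonneg hn hu) (inv_nonneg.2 (sub_nonneg.2 (Real.exp_le_one_iff.2 ?_)))
    have : 0 < u / z := by positivity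
    linarith
  have : ENNReal.ofReal (SS n (1 / 2) + SS n (1 / 2)) ≤ ENNReal.ofReal (SS n x + SS n y) := by
    rw [ENNReal.ofReal_add (SS_nonneg hn hh) (SS_nonneg hn hh), ENNReal.ofReal_add sx sy,
      SS_lintegral hn hx, SS_lintegral hn hy, SS_lintegral hn hh,
      ← lintegral_add_left (hm _), ← lintegral_add_left (hm _)]
    refine setLIntegral_mono' measurableSet_Ioi fun u hu => ?_
    rw [← ENNReal.ofReal_add (hpos u _ hu hh) (hpos u _ hu hh),
      ← ENNReal.ofReal_add (hpos u _ hu hx) (hpos u _ hu hy)]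
    apply ENNReal.ofReal_le_ofReal
    have := mul_le_mul_of_nonneg_left (pointwise hu hx hy hxy) (KK_nonneg hn hu)
    linarith
  have := (ENNReal.ofReal_le_ofReal_iff (add_nonneg sx sy)).1 this
  linarith

lemma SS_half {n : ℝ} (hn : 1 ≤ n) : SS n (1 / 2) = Real.log n := by
  have h1 : (n + 2) * (1 / 2) = n * (1 / 2) + 1 := by ring
  have h2 : (3:ℝ) * (1 / 2) = 1 / 2 + 1 := by norm_num
  have g1 : 0 < Real.Gamma (1 / 2) := Real.Gamma_pos_of_pos (by norm_num)
  have g2 : 0 < Real.Gamma (n * (1 / 2)) := Real.Gamma_pos_of_pos (by positivity)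
  rw [SS, h1, h2, Real.Gamma_add_one (by positivity), Real.Gamma_add_one (by positivity),
    Real.log_mul (by positivity) (by positivity), Real.log_mul (by positivity) (by positivity),
    Real.log_mul (by positivity) (by positivity)]
  ring

lemma prod_ineq {n x y : ℝ} (hn : 1 ≤ n) (hx : 0 < x) (hy : 0 < y) (hxy : x + y = 1) :
    n ^ 2 * (Real.Gamma (3 * x) * Real.Gamma (3 * y) * Real.Gamma (n * x) * Real.Gamma (n * y)) ≤
      Real.Gamma x * Real.Gamma y * Real.Gamma ((n + 2) * x) * Real.Gamma ((n + 2) * y) := by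
  have h := SS_ineq hn hx hy hxy
  rw [SS_half hn, SS, SS] at h
  have hn0 : 0 < n := by linarith
  have g : ∀ z : ℝ, 0 < z → 0 < Real.Gamma z := fun z => Real.Gamma_pos_of_pos
  have g1 := g x hx
  have g2 := g y hy
  have g3 := g (3 * x) (by positivity)
  have g4 := g (3 * y) (by positivity)
  have g5 := g (n * x) (by positivity)
  have g6 := g (n * y) (by positivity)
  have g7 := g ((n + 2) * x) (by positivity)
  have g8 := g ((n + 2) * y) (by positivity)
  rw [← Real.log_le_log_iff (by positivity) (by positivity),
    Real.log_mul (by positivity) (by positivity), Real.log_mul (by positivity) (by positivity),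
    Real.log_mul (by positivity) (by positivity), Real.log_mul (by positivity) (by positivity),
    Real.log_mul (by positivity) (by positivity), Real.log_mul (by positivity) (by positivity),
    Real.log_mul (by positivity) (by positivity), Real.log_pow]
  push_cast
  linarith

theorem kuperberg_gamma_ineq (n : ℕ) (hn : 1 ≤ n) (p : ℝ) (hp1 : 1 < p) :
    (n : ℝ) * (Real.Gamma (3 / p) * Real.Gamma (3 / (p / (p - 1))) *
          Real.Gamma (1 + n / p) * Real.Gamma (1 + n / (p / (p - 1)))) /
        (Real.Gamma (1 / p) * Real.Gamma (1 / (p / (p - 1))) *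
          Real.Gamma (1 + ((n : ℝ) + 2) / p) *
          Real.Gamma (1 + ((n : ℝ) + 2) / (p / (p - 1)))) ≤
      (n : ℝ) / ((n : ℝ) + 2) ^ 2 := by
  have hn' : (1:ℝ) ≤ n := by exact_mod_cast hn
  generalize (n : ℝ) = N at hn'
  have hp : 0 < p := by linarith
  have hp' : 0 < p - 1 := by linarith
  obtain ⟨x, hxd⟩ : ∃ x, x = 1 / p := ⟨_, rfl⟩
  obtain ⟨y, hyd⟩ : ∃ y, y = 1 / (p / (p - 1)) := ⟨_, rfl⟩
  have hx : 0 < x := by rw [hxd]; positivity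
  have hy : 0 < y := by rw [hyd]; positivity
  have hxy : x + y = 1 := by rw [hxd, hyd]; field_simp; ring
  have ex : ∀ c : ℝ, c / p = c * x := fun c => by rw [hxd]; ring
  have ey : ∀ c : ℝ, c / (p / (p - 1)) = c * y := fun c => by rw [hyd]; ring
  have h := prod_ineq hn' hx hy hxy
  have hN : 0 < N := by linarith
  simp only [ex, ey, one_mul]
  rw [add_comm 1 (N * x), add_comm 1 (N * y), add_comm 1 ((N + 2) * x),
    add_comm 1 ((N + 2) * y), Real.Gamma_add_one (by positivity),
    Real.Gamma_add_one (by positivity), Real.Gamma_add_one (by positivity),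
    Real.Gamma_add_one (by positivity)]
  have g : ∀ z : ℝ, 0 < z → 0 < Real.Gamma z := fun z => Real.Gamma_pos_of_pos
  have g1 := g x hx
  have g2 := g y hy
  have g7 := g ((N + 2) * x) (by positivity)
  have g8 := g ((N + 2) * y) (by positivity)
  rw [div_le_div_iff₀ (by positivity) (by positivity)]
  have := mul_le_mul_of_nonneg_left h (show 0 ≤ N * (N + 2) ^ 2 * x * y by positivity)
  linarith
end
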